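/- Let V_1 = (Y_1,C_1,τ_1),…,V_k = (Y_k,C_k,τ_k) be infinitesimal stochastic transformations on an open set M ⊆ ℝ^n such that K = span{V_1,…,V_k} is a Lie algebra under the bracket [V,V'] = ([Y,Y'], Y(C') − Y'(C) − (C·C' − C'·C), Y(τ') − Y'(τ)). If x₀ ∈ M is such that Y_1(x₀),…,Y_k(x₀) are linearly independent, then there exist an open neighborhood U of x₀ and smooth functions B: U → SO(m), η: U → (0,∞) such that, for every i = 1,…,k, Y_i(B) = −B·C_i and Y_i(η) = −τ_i·η hold on U; equivalently, the stochastic transformation T = (id_U, B, η) is such that T_*(V_1),…,T_*(V_k) are strong infinitesimal stochastic transformations. -/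

import Mathlib

noncomputable section

open scoped BigOperators

/-- Partial derivative `∂_j f` at `x`. -/
def pd {d : ℕ} (f : (Fin d → ℝ) → ℝ) (j : Fin d) (x : Fin d → ℝ) : ℝ :=
  fderiv ℝ f x (Pi.single j 1)

/-- A vector field `Y` applied to a scalar function: `Y(f) = ∑ k Y^k ∂_k f`. -/
def vfApp {d : ℕ} (Y : (Fin d → ℝ) → Fin d → ℝ) (f : (Fin d → ℝ) → ℝ)
    (x : Fin d → ℝ) : ℝ :=
  ∑ k, Y x k * pd f k x

/-- Lie bracket of two vector fields. -/
def vfBracket {d : ℕ} (X Y : (Fin d → ℝ) → Fin d → ℝ) (x : Fin d → ℝ) :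
    Fin d → ℝ :=
  fun i => ∑ k, (X x k * pd (fun y => Y y i) k x - Y x k * pd (fun y => X y i) k x)

/-- The bracket `[H,K]` of a vector field `H` with a matrix-valued map `K`. -/
def mixBracket {d m : ℕ} (H : (Fin d → ℝ) → Fin d → ℝ)
    (K : (Fin d → ℝ) → Fin d → Fin m → ℝ) (x : Fin d → ℝ) : Fin d → Fin m → ℝ :=
  fun i j => ∑ k, (H x k * pd (fun y => K y i j) k x - K x k j * pd (fun y => H y i) k x)

/-- The generator `L` of the SDE `(μ,σ)`. -/
def gen {d m : ℕ} (μ : (Fin d → ℝ) → Fin d → ℝ)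
    (σ : (Fin d → ℝ) → Fin d → Fin m → ℝ)
    (f : (Fin d → ℝ) → ℝ) (x : Fin d → ℝ) : ℝ :=
  (1/2) * ∑ α : Fin m, ∑ i, ∑ j, σ x i α * σ x j α * pd (fun y => pd f j y) i x
    + ∑ i, μ x i * pd f i x

/-- The determining equations: `(Y,C,τ)` is an infinitesimal symmetry of `(μ,σ)` on `M`. -/
def IsSymmetry {d m : ℕ} (M : Set (Fin d → ℝ))
    (μ : (Fin d → ℝ) → Fin d → ℝ) (σ : (Fin d → ℝ) → Fin d → Fin m → ℝ)
    (Y : (Fin d → ℝ) → Fin d → ℝ) (C : (Fin d → ℝ) → Fin m → Fin m → ℝ)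
    (τ : (Fin d → ℝ) → ℝ) : Prop :=
  (∀ x ∈ M, ∀ i α, mixBracket Y σ x i α
      = -(1/2) * τ x * σ x i α - ∑ β, σ x i β * C x β α) ∧
  (∀ x ∈ M, ∀ i,
      vfApp Y (fun y => μ y i) x - gen μ σ (fun y => Y y i) x = - τ x * μ x i)

open scoped ContDiff

section Superposition

universe u v

/-- Pointwise application of a continuous family of linear maps, as a bounded bilinear map. -/
def ContinuousMap.pointwiseApplyCLM (K : Type u) [TopologicalSpace K] [CompactSpace K]
    (E F : Type v) [NormedAddCommGroup E] [NormedSpace ℝ E]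
    [NormedAddCommGroup F] [NormedSpace ℝ F] :
    C(K, E →L[ℝ] F) →L[ℝ] C(K, E) →L[ℝ] C(K, F) :=
  LinearMap.mkContinuous₂
    (LinearMap.mk₂ ℝ (fun (A : C(K, E →L[ℝ] F)) (h : C(K, E)) =>
      (⟨fun t => A t (h t), A.continuous.clm_apply h.continuous⟩ : C(K, F)))
      (fun _ _ _ => by ext; simp) (fun _ _ _ => by ext; simp)
      (fun _ _ _ => by ext; simp) (fun _ _ _ => by ext; simp)) 1
    (fun A h => by
      rw [ContinuousMap.norm_le _ (by positivity)]
      intro t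
      rw [one_mul]
      exact ((A t).le_opNorm _).trans
        (mul_le_mul (A.norm_coe_le_norm t) (h.norm_coe_le_norm t) (by positivity) (by positivity)))

variable {K : Type u} [TopologicalSpace K] [CompactSpace K]

theorem ContinuousMap.hasFDerivAt_comp_left {E F : Type v}
    [NormedAddCommGroup E] [NormedSpace ℝ E] [NormedAddCommGroup F] [NormedSpace ℝ F]
    (f : C(E, F)) (f' : C(E, E →L[ℝ] F)) (hf : ∀ x, HasFDerivAt f (f' x) x) (γ : C(K, E)) :
    HasFDerivAt (fun γ : C(K, E) => f.comp γ)
      (ContinuousMap.pointwiseApplyCLM K E F (f'.comp γ)) γ := by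
  rw [hasFDerivAt_iff_isLittleO_nhds_zero, Asymptotics.isLittleO_iff]
  intro ε hε
  have hc : Continuous (fun γ : C(K, E) => f'.comp γ) := ContinuousMap.continuous_postcomp f'
  obtain ⟨δ, hδ, hδε⟩ := (Metric.continuousAt_iff (f := fun γ : C(K, E) => f'.comp γ) (a := γ)).1
    hc.continuousAt ε hε
  filter_upwards [Metric.ball_mem_nhds (0 : C(K, E)) hδ] with h hh
  rw [ContinuousMap.norm_le _ (by positivity)]
  intro t
  have hseg : ∀ x ∈ segment ℝ (γ t) (γ t + h t), ‖f' x - f' (γ t)‖ ≤ ε := by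
    intro x hx
    rw [segment_eq_image'] at hx
    obtain ⟨s, ⟨hs0, hs1⟩, rfl⟩ := hx
    have hd : dist (γ + s • h) γ < δ := by
      rw [dist_eq_norm, add_sub_cancel_left, norm_smul, Real.norm_of_nonneg hs0]
      rw [mem_ball_zero_iff] at hh
      nlinarith [norm_nonneg h]
    have := (ContinuousMap.dist_apply_le_dist t).trans (hδε hd).le
    rw [dist_eq_norm] at this
    simpa using this
  have := (convex_segment (γ t) (γ t + h t)).norm_image_sub_le_of_norm_hasFDerivWithin_le'
    (fun x _ => (hf x).hasFDerivWithinAt) hseg (left_mem_segment ℝ _ _) (right_mem_segment ℝ _ _)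
  simp only [add_sub_cancel_left] at this
  exact this.trans (mul_le_mul_of_nonneg_left (h.norm_coe_le_norm t) hε.le)

theorem ContinuousMap.contDiff_nat_comp_left (n : ℕ) {E : Type v}
    [NormedAddCommGroup E] [NormedSpace ℝ E] :
    ∀ {F : Type v} [NormedAddCommGroup F] [NormedSpace ℝ F] (f : C(E, F)), ContDiff ℝ n f →
      ContDiff ℝ n (fun γ : C(K, E) => f.comp γ) := by
  induction n with
  | zero =>
    intro F _ _ f _
    exact contDiff_zero.2 (ContinuousMap.continuous_postcomp f)
  | succ n ih =>
    intro F _ _ f hf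
    rw [Nat.cast_succ] at hf ⊢
    have h := contDiff_succ_iff_fderiv.1 hf
    let f' : C(E, E →L[ℝ] F) := ⟨fderiv ℝ f, h.2.2.continuous⟩
    have hd := ContinuousMap.hasFDerivAt_comp_left (K := K) f f'
      (fun x => (h.1 x).hasFDerivAt)
    refine contDiff_succ_iff_fderiv.2 ⟨fun γ => (hd γ).differentiableAt, by simp, ?_⟩
    rw [funext fun γ => (hd γ).fderiv]
    exact (ContinuousMap.pointwiseApplyCLM K E F).contDiff.comp (ih f' h.2.2)

theorem ContinuousMap.contDiff_comp_left {E F : Type v}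
    [NormedAddCommGroup E] [NormedSpace ℝ E] [NormedAddCommGroup F] [NormedSpace ℝ F]
    (f : C(E, F)) (hf : ContDiff ℝ ∞ f) :
    ContDiff ℝ ∞ (fun γ : C(K, E) => f.comp γ) :=
  contDiff_infty.2 fun n => ContinuousMap.contDiff_nat_comp_left n f (contDiff_infty.1 hf n)

end Superposition

/-- A smooth map with invertible derivative at a point is locally a smooth diffeomorphism. -/
theorem ContDiffOn.exists_smooth_local_inverse {E F : Type*}
    [NormedAddCommGroup E] [NormedSpace ℝ E] [CompleteSpace E]
    [NormedAddCommGroup F] [NormedSpace ℝ F]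
    {f : E → F} {s : Set E} (hs : IsOpen s) (hf : ContDiffOn ℝ ∞ f s) {a : E} (ha : a ∈ s)
    (e : E ≃L[ℝ] F) (he : HasFDerivAt f (e : E →L[ℝ] F) a) :
    ∃ φ : OpenPartialHomeomorph E F, a ∈ φ.source ∧ φ.source ⊆ s ∧ (φ : E → F) = f ∧
      ContDiffOn ℝ ∞ φ.symm φ.target := by
  have hfa : ContDiffAt ℝ ∞ f a := hf.contDiffAt (hs.mem_nhds ha)
  let φ₀ := hfa.toOpenPartialHomeomorph f he (by simp)
  have ho : IsOpen (s ∩ fderiv ℝ f ⁻¹' Set.range ((↑) : (E ≃L[ℝ] F) → E →L[ℝ] F)) :=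
    (hf.continuousOn_fderiv_of_isOpen hs (by simp)).isOpen_inter_preimage hs
      ContinuousLinearEquiv.isOpen
  refine ⟨φ₀.restrOpen _ ho, ⟨hfa.mem_toOpenPartialHomeomorph_source he (by simp), ha, e,
    he.fderiv.symm⟩, fun x hx => hx.2.1, rfl, ?_⟩
  intro y hy
  have hy' := (φ₀.restrOpen _ ho).map_target hy
  obtain ⟨hxs, e', he'⟩ := hy'.2
  refine ((φ₀.restrOpen _ ho).contDiffAt_symm hy (f₀' := e') ?_
    (hf.contDiffAt (hs.mem_nhds hxs))).contDiffWithinAt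
  rw [he']
  exact ((hf.contDiffAt (hs.mem_nhds hxs)).differentiableAt (by simp)).hasFDerivAt

section Flow

universe v

/-- The Volterra operator `γ ↦ ∫₀ᵗ γ` on continuous curves over the unit interval. -/
def volterraCLM (E : Type v) [NormedAddCommGroup E] [NormedSpace ℝ E] :
    C(unitInterval, E) →L[ℝ] C(unitInterval, E) :=
  LinearMap.mkContinuous
    { toFun := fun γ => ⟨fun t => ∫ σ in (0 : ℝ)..t, Set.IccExtend zero_le_one γ σ,
        (intervalIntegral.continuous_primitive
          (fun a b => (γ.continuous.Icc_extend').intervalIntegrable a b) 0).comp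
          continuous_subtype_val⟩
      map_add' := fun γ δ => by
        ext t
        exact intervalIntegral.integral_add ((γ.continuous.Icc_extend').intervalIntegrable _ _)
          ((δ.continuous.Icc_extend').intervalIntegrable _ _)
      map_smul' := fun c γ => by
        ext t
        exact intervalIntegral.integral_smul c _ } 1
    (fun γ => by
      rw [one_mul, ContinuousMap.norm_le _ (norm_nonneg _)]
      intro t
      refine (intervalIntegral.norm_integral_le_of_norm_le_const
        (C := ‖γ‖) fun σ _ => γ.norm_coe_le_norm _).trans ?_
      rw [sub_zero, abs_of_nonneg t.2.1]
      exact mul_le_of_le_one_right (norm_nonneg _) t.2.2)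

/-- The constant curves, as a bounded linear map. -/
def constCLM (E : Type v) [NormedAddCommGroup E] [NormedSpace ℝ E] :
    E →L[ℝ] C(unitInterval, E) :=
  LinearMap.mkContinuous
    { toFun := fun x => ContinuousMap.const _ x
      map_add' := fun _ _ => rfl
      map_smul' := fun _ _ => rfl } 1
    (fun x => by
      rw [one_mul, ContinuousMap.norm_le _ (norm_nonneg _)]
      intro t
      exact le_rfl)

theorem constCLM_apply {E : Type v} [NormedAddCommGroup E] [NormedSpace ℝ E]
    (x : E) (t : unitInterval) : constCLM E x t = x := rfl

variable {P E : Type v} [NormedAddCommGroup P]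
  [NormedAddCommGroup E] [NormedSpace ℝ E]

/-- The Picard operator of a vector field on `E` with parameters in `P`. -/
def picardMap (F : C(P × E, E)) (q : (P × E) × C(unitInterval, E)) : C(unitInterval, E) :=
  constCLM E q.1.2 + volterraCLM E (F.comp ((ContinuousMap.const _ q.1.1).prodMk q.2))

theorem picardMap_apply (F : C(P × E, E)) (q : (P × E) × C(unitInterval, E)) (t : unitInterval) :
    picardMap F q t =
      q.1.2 + ∫ σ in (0 : ℝ)..t, F (q.1.1, Set.IccExtend zero_le_one q.2 σ) := rfl

variable [NormedSpace ℝ P]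

theorem contDiff_picardMap (F : C(P × E, E)) (hF : ContDiff ℝ ∞ F) :
    ContDiff ℝ ∞ (picardMap F) := by
  have h1 : ContDiff ℝ ∞ (fun q : (P × E) × C(unitInterval, E) =>
      (ContinuousMap.const unitInterval q.1.1).prodMk q.2) := by
    have : (fun q : (P × E) × C(unitInterval, E) =>
        (ContinuousMap.const unitInterval q.1.1).prodMk q.2) = fun q =>
        (ContinuousLinearMap.inl ℝ P E).compLeftContinuous ℝ unitInterval (constCLM P q.1.1) +
        (ContinuousLinearMap.inr ℝ P E).compLeftContinuous ℝ unitInterval q.2 := by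
      funext q
      ext t <;> simp [constCLM_apply]
    rw [this]
    exact (((ContinuousLinearMap.inl ℝ P E).compLeftContinuous ℝ unitInterval).contDiff.comp
        ((constCLM P).contDiff.comp (contDiff_fst.comp contDiff_fst))).add
      (((ContinuousLinearMap.inr ℝ P E).compLeftContinuous ℝ unitInterval).contDiff.comp
        contDiff_snd)
  exact ((constCLM E).contDiff.comp (contDiff_snd.comp contDiff_fst)).add
    ((volterraCLM E).contDiff.comp ((ContinuousMap.contDiff_comp_left F hF).comp h1))

/-- The shear `(v, w) ↦ (v, w - L v)`. -/
def shearEquiv {V W : Type*} [NormedAddCommGroup V] [NormedSpace ℝ V]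
    [NormedAddCommGroup W] [NormedSpace ℝ W] (L : V →L[ℝ] W) : (V × W) ≃L[ℝ] (V × W) :=
  ContinuousLinearEquiv.equivOfInverse
    ((ContinuousLinearMap.fst ℝ V W).prod
      (ContinuousLinearMap.snd ℝ V W - L.comp (ContinuousLinearMap.fst ℝ V W)))
    ((ContinuousLinearMap.fst ℝ V W).prod
      (ContinuousLinearMap.snd ℝ V W + L.comp (ContinuousLinearMap.fst ℝ V W)))
    (fun x => by ext <;> simp) (fun x => by ext <;> simp)

/-- If a vector field depends homogeneously on its parameter, a rescaled solution solves the
equation with rescaled parameter. -/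
theorem picardMap_rescale (F : C(P × E, E)) (hhom : ∀ (t : ℝ) p x, F (t • p, x) = t • F (p, x))
    {p : P} {y : E} {γ : C(unitInterval, E)} (hγ : picardMap F ((p, y), γ) = γ)
    (t : unitInterval) (u : C(unitInterval, E)) (hu : ∀ s, u s = γ (t * s)) :
    picardMap F (((t : ℝ) • p, y), u) = u := by
  ext s
  rw [picardMap_apply, hu, ← hγ, picardMap_apply]
  congr 1
  simp only [hhom]
  rw [intervalIntegral.integral_smul, Set.Icc.coe_mul]
  have h := intervalIntegral.smul_integral_comp_mul_left
    (fun σ => F (p, Set.IccExtend zero_le_one γ σ)) (a := 0) (b := s) (t : ℝ)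
  rw [mul_zero] at h
  rw [← h]
  congr 1
  refine intervalIntegral.integral_congr fun σ hσ => ?_
  rw [Set.uIcc_of_le s.2.1] at hσ
  have hσ' : σ ∈ Set.Icc (0 : ℝ) 1 := ⟨hσ.1, hσ.2.trans s.2.2⟩
  have htσ : (t : ℝ) * σ ∈ Set.Icc (0 : ℝ) 1 := unitInterval.mul_mem t.2 hσ'
  rw [Set.IccExtend_of_mem _ _ hσ', Set.IccExtend_of_mem _ _ htσ, hu]
  rfl

/-- Smooth time-one flow of a vector field on `E` depending smoothly and homogeneously on a
parameter in `P`. -/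
theorem exists_smooth_timeOne_flow [CompleteSpace P] [CompleteSpace E] (F : P × E → E)
    (hF : ContDiff ℝ ∞ F)
    (hhom : ∀ (t : ℝ) p x, F (t • p, x) = t • F (p, x)) (z₀ : E) :
    ∃ r > 0, ∃ Ψ : P × E → E, ContDiffOn ℝ ∞ Ψ (Metric.ball (0, z₀) r) ∧
      (∀ q ∈ Metric.ball ((0 : P), z₀) r, Ψ (0, q.2) = q.2) ∧
      ∀ q ∈ Metric.ball ((0 : P), z₀) r, ∀ t ∈ Set.Icc (0 : ℝ) 1,
        fderiv ℝ Ψ (t • q.1, q.2) (q.1, 0) = F (q.1, Ψ (t • q.1, q.2)) := by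
  let F' : C(P × E, E) := ⟨F, hF.continuous⟩
  have hK : ContDiff ℝ ∞ (picardMap F') := contDiff_picardMap F' hF
  have hF0 : ∀ x, F (0, x) = 0 := fun x => by simpa using hhom 0 0 x
  let H : (P × E) × C(unitInterval, E) → (P × E) × C(unitInterval, E) :=
    fun q => (q.1, q.2 - picardMap F' q)
  have hH : ContDiff ℝ ∞ H := contDiff_fst.prodMk (contDiff_snd.sub hK)
  let a : (P × E) × C(unitInterval, E) := ((0, z₀), constCLM E z₀)
  have hK0 : ∀ y γ, picardMap F' ((0, y), γ) = constCLM E y := by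
    intro y γ
    ext t
    rw [picardMap_apply]
    simp [F', hF0, constCLM_apply]
  let D := fderiv ℝ (picardMap F') a
  have hD : HasFDerivAt (picardMap F') D a := (hK.differentiable (by simp) a).hasFDerivAt
  have hD0 : ∀ δ, D (0, δ) = 0 := by
    intro δ
    have h1 : HasFDerivAt (fun γ : C(unitInterval, E) => picardMap F' ((0, z₀), γ))
        (D.comp (ContinuousLinearMap.inr ℝ (P × E) C(unitInterval, E))) (constCLM E z₀) :=
      hD.comp (constCLM E z₀) (hasFDerivAt_prodMk_right (0, z₀) (constCLM E z₀))
    simp only [hK0] at h1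
    have := h1.unique (hasFDerivAt_const _ _)
    simpa using congrArg (fun L => L δ) this
  let e := shearEquiv (D.comp (ContinuousLinearMap.inl ℝ (P × E) C(unitInterval, E)))
  have he : HasFDerivAt H (e : _ →L[ℝ] _) a := by
    refine (hasFDerivAt_fst.prodMk (hasFDerivAt_snd.sub hD)).congr_fderiv ?_
    refine ContinuousLinearMap.ext fun w => ?_
    have : D w = D (w.1, 0) := by
      have h : w = (w.1, 0) + (0, w.2) := by simp
      conv_lhs => rw [h, map_add, hD0, add_zero]
    simp [e, shearEquiv, this]
  obtain ⟨φ, haφ, -, hφ, hsymm⟩ :=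
    hH.contDiffOn.exists_smooth_local_inverse isOpen_univ (Set.mem_univ a) e he
  have hHa : H a = ((0, z₀), 0) := by simp [H, a, hK0]
  let ι : P × E → (P × E) × C(unitInterval, E) := fun q => (q, 0)
  have hι : ContDiff ℝ ∞ ι := contDiff_id.prodMk contDiff_const
  let T : Set (P × E) := ι ⁻¹' φ.target
  have hT : IsOpen T := φ.open_target.preimage hι.continuous
  have h0T : ((0 : P), z₀) ∈ T := by
    have := φ.map_source haφ
    rwa [hφ, hHa] at this
  let Γ : P × E → C(unitInterval, E) := fun q => (φ.symm (ι q)).2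
  have hΓ : ContDiffOn ℝ ∞ Γ T :=
    contDiff_snd.comp_contDiffOn (hsymm.comp hι.contDiffOn (fun _ h => h))
  have hΓfix : ∀ q ∈ T, picardMap F' (q, Γ q) = Γ q := by
    intro q hq
    have h1 := φ.right_inv hq
    rw [hφ] at h1
    have h2 : (φ.symm (ι q)).1 = q := congrArg Prod.fst h1
    have h3 : Γ q - picardMap F' (φ.symm (ι q)) = 0 := congrArg Prod.snd h1
    have h4 : φ.symm (ι q) = (q, Γ q) := Prod.ext h2 rfl
    rw [h4] at h3
    exact (sub_eq_zero.1 h3).symm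
  have hΓuniq : ∀ q u, (q, u) ∈ φ.source → picardMap F' (q, u) = u → q ∈ T ∧ Γ q = u := by
    intro q u hs hu
    have h1 : H (q, u) = ι q := by simp [H, ι, hu]
    have h2 := φ.map_source hs
    have h3 := φ.left_inv hs
    rw [hφ, h1] at h2 h3
    exact ⟨h2, congrArg Prod.snd h3⟩
  have hΓ0 : Γ (0, z₀) = constCLM E z₀ := (hΓuniq _ _ haφ (hK0 _ _)).2
  obtain ⟨ε, hε, hεs⟩ := Metric.isOpen_iff.1 φ.open_source a haφ
  have hΓc : ContinuousAt Γ (0, z₀) := hΓ.continuousOn.continuousAt (hT.mem_nhds h0T)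
  obtain ⟨r₁, hr₁, hr₁T⟩ := Metric.isOpen_iff.1 hT _ h0T
  obtain ⟨r₂, hr₂, hr₂Γ⟩ := Metric.continuousAt_iff.1 hΓc ε hε
  rw [hΓ0] at hr₂Γ
  have key : ∀ q ∈ Metric.ball ((0 : P), z₀) (min ε (min r₁ r₂)), ∀ t : unitInterval,
      ∀ s : unitInterval, Γ ((t : ℝ) • q.1, q.2) s = Γ q (t * s) := by
    intro q hq t s
    simp only [Metric.mem_ball, lt_min_iff] at hq
    let u : C(unitInterval, E) := (Γ q).comp ⟨fun s => t * s, by fun_prop⟩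
    have hu : picardMap F' (((t : ℝ) • q.1, q.2), u) = u :=
      picardMap_rescale F' hhom (hΓfix q (hr₁T hq.2.1)) t u fun _ => rfl
    have hmem : (((t : ℝ) • q.1, q.2), u) ∈ φ.source := by
      apply hεs
      have h1 := hq.1
      rw [Prod.dist_eq, max_lt_iff] at h1
      rw [Metric.mem_ball, Prod.dist_eq, max_lt_iff, Prod.dist_eq, max_lt_iff]
      refine ⟨⟨?_, h1.2⟩, ?_⟩
      · have h2 := h1.1
        simp only [a, dist_zero_right, norm_smul, Real.norm_of_nonneg t.2.1] at h2 ⊢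
        exact (mul_le_of_le_one_left (norm_nonneg _) t.2.2).trans_lt h2
      · refine lt_of_le_of_lt ?_ (hr₂Γ hq.2.2)
        refine (ContinuousMap.dist_le dist_nonneg).2 fun s => ?_
        exact ContinuousMap.dist_apply_le_dist (f := Γ q) (g := constCLM E z₀) (t * s)
    exact congrArg (fun γ => γ s) (hΓuniq _ _ hmem hu).2
  let Ψ : P × E → E := fun q => Γ q 1
  have hΨ : ContDiffOn ℝ ∞ Ψ T :=
    (ContinuousMap.evalCLM ℝ (1 : unitInterval) (M := E)).contDiff.comp_contDiffOn hΓ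
  have hΨΓ : ∀ q ∈ Metric.ball ((0 : P), z₀) (min ε (min r₁ r₂)), ∀ t : unitInterval,
      Ψ ((t : ℝ) • q.1, q.2) = Γ q t := fun q hq t => by
    simpa using key q hq t 1
  have hball : Metric.ball ((0 : P), z₀) (min ε (min r₁ r₂)) ⊆ T :=
    (Metric.ball_subset_ball ((min_le_right _ _).trans (min_le_left _ _))).trans hr₁T
  refine ⟨min ε (min r₁ r₂), by positivity, Ψ, hΨ.mono hball, ?_, ?_⟩
  · intro q hq
    have h := hΨΓ q hq 0
    rw [← hΓfix q (hball hq), picardMap_apply] at h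
    simpa using h
  · intro q hq t ht
    have hmem : (t • q.1, q.2) ∈ T := by
      apply hball
      rw [Metric.mem_ball, Prod.dist_eq, max_lt_iff] at hq ⊢
      refine ⟨?_, hq.2⟩
      have h2 := hq.1
      simp only [dist_zero_right, norm_smul, Real.norm_of_nonneg ht.1] at h2 ⊢
      exact (mul_le_of_le_one_left (norm_nonneg _) ht.2).trans_lt h2
    have hd : HasFDerivAt Ψ (fderiv ℝ Ψ (t • q.1, q.2)) (t • q.1, q.2) :=
      ((hΨ.contDiffAt (hT.mem_nhds hmem)).differentiableAt (by simp)).hasFDerivAt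
    have hcurve : HasDerivAt (fun t : ℝ => (t • q.1, q.2)) (q.1, (0 : E)) t := by
      simpa using ((hasDerivAt_id t).smul_const q.1).prodMk (hasDerivAt_const t q.2)
    have h1 : HasDerivWithinAt (fun t : ℝ => Ψ (t • q.1, q.2))
        (fderiv ℝ Ψ (t • q.1, q.2) (q.1, 0)) (Set.Icc 0 1) t :=
      (HasFDerivAt.comp_hasDerivAt (f := fun t : ℝ => (t • q.1, q.2)) t hd
        hcurve).hasDerivWithinAt
    let g : ℝ → E := fun σ => F (q.1, Set.IccExtend zero_le_one (Γ q) σ)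
    have hg : Continuous g :=
      hF.continuous.comp (continuous_const.prodMk (Γ q).continuous.Icc_extend')
    have heq : ∀ t ∈ Set.Icc (0 : ℝ) 1, Ψ (t • q.1, q.2) = q.2 + ∫ σ in (0 : ℝ)..t, g σ := by
      intro t ht
      rw [hΨΓ q hq ⟨t, ht⟩, ← hΓfix q (hball hq), picardMap_apply]
      rfl
    have h2 : HasDerivWithinAt (fun t : ℝ => Ψ (t • q.1, q.2)) (g t) (Set.Icc 0 1) t :=
      (((intervalIntegral.integral_hasDerivAt_right (hg.intervalIntegrable _ _)
        (hg.stronglyMeasurableAtFilter _ _) hg.continuousAt).const_add q.2).hasDerivWithinAt).congr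
        heq (heq t ht)
    rw [(uniqueDiffOn_Icc zero_lt_one t ht).eq_deriv _ h1 h2]
    simp only [g]
    rw [Set.IccExtend_of_mem _ _ ht, ← hΨΓ q hq ⟨t, ht⟩]

end Flow

section FlatSections

open Metric Set

/-- A function smooth on an open set agrees near any of its points with a globally smooth one. -/
theorem ContDiffOn.exists_contDiff_eventuallyEq {E F : Type*} [NormedAddCommGroup E]
    [NormedSpace ℝ E] [FiniteDimensional ℝ E] [NormedAddCommGroup F] [NormedSpace ℝ F]
    {f : E → F} {s : Set E} (hs : IsOpen s) (hf : ContDiffOn ℝ ∞ f s) {x₀ : E} (hx₀ : x₀ ∈ s) :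
    ∃ g : E → F, ContDiff ℝ ∞ g ∧ g =ᶠ[nhds x₀] f := by
  obtain ⟨ε, hε, hεs⟩ := Metric.isOpen_iff.1 hs x₀ hx₀
  let ρ : ContDiffBump x₀ := ⟨ε / 4, ε / 2, by positivity, by linarith⟩
  refine ⟨fun x => ρ x • f x, ?_, ?_⟩
  · rw [contDiff_iff_contDiffAt]
    intro x
    by_cases hx : x ∈ s
    · exact ρ.contDiff.contDiffAt.smul (hf.contDiffAt (hs.mem_nhds hx))
    · have hxt : x ∉ tsupport ρ := by
        rw [ρ.tsupport_eq]
        exact fun h => hx (hεs (closedBall_subset_ball (by simp only [ρ]; linarith) h))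
      have h0 : (fun x => ρ x • f x) =ᶠ[nhds x] fun _ => 0 := by
        filter_upwards [(isClosed_tsupport ρ).isOpen_compl.mem_nhds hxt] with y hy
        rw [image_eq_zero_of_notMem_tsupport hy, zero_smul]
      exact contDiffAt_const.congr_of_eventuallyEq h0
  · filter_upwards [ρ.eventuallyEq_one] with x hx
    rw [hx, Pi.one_apply, one_smul]

/-- Grönwall's lemma for the singular equation `t r' = -r + O(t) r`. -/
theorem eq_zero_of_norm_smul_deriv_add_le {V : Type*} [NormedAddCommGroup V] [NormedSpace ℝ V]
    {r r' : ℝ → V} {K : ℝ} (hr : ∀ t ∈ Icc (0 : ℝ) 1, HasDerivAt r (r' t) t)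
    (hK : ∀ t ∈ Icc (0 : ℝ) 1, ‖t • r' t + r t‖ ≤ K * (t * ‖r t‖)) : r 1 = 0 := by
  have hd : ∀ t ∈ Icc (0 : ℝ) 1, HasDerivAt (fun t => t • r t) (t • r' t + r t) t := by
    intro t ht
    simpa using (hasDerivAt_id t).fun_smul (hr t ht)
  have h := eq_zero_of_abs_deriv_le_mul_abs_self_of_eq_zero_right (K := K)
    (fun t ht => (hd t ht).continuousAt.continuousWithinAt)
    (fun t ht => (hd t (Ico_subset_Icc_self ht)).hasDerivWithinAt) (zero_smul _ _)
    (fun t ht => by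
      rw [norm_smul, Real.norm_of_nonneg ht.1]
      exact hK t (Ico_subset_Icc_self ht)) 1 (right_mem_Icc.2 zero_le_one)
  simpa using h

variable {E A : Type} [NormedAddCommGroup E] [NormedSpace ℝ E]
  [NormedRing A] [NormedAlgebra ℝ A]

/-- The defect of `B` from being flat satisfies a linear equation in the radial direction. -/
theorem fderiv_flatness_defect_radial {k : ℕ} {U : Set E} (hU : IsOpen U)
    {Y : Fin k → E → E} {C : Fin k → E → A} {c : Fin k → Fin k → Fin k → ℝ}
    {B : E → A} {σ : Fin k → E → ℝ}
    (hY : ∀ i, ContDiff ℝ ∞ (Y i)) (hC : ∀ i, ContDiff ℝ ∞ (C i))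
    (hB : ContDiffOn ℝ ∞ B U) (hσ : ∀ i, ContDiffOn ℝ ∞ (σ i) U)
    (hbrY : ∀ i j, ∀ x ∈ U,
      fderiv ℝ (Y j) x (Y i x) - fderiv ℝ (Y i) x (Y j x) = ∑ l, c i j l • Y l x)
    (hbrC : ∀ i j, ∀ x ∈ U,
      fderiv ℝ (C j) x (Y i x) - fderiv ℝ (C i) x (Y j x) - (C i x * C j x - C j x * C i x)
        = ∑ l, c i j l • C l x)
    (hrad : ∀ x ∈ U, fderiv ℝ B x (∑ i, σ i x • Y i x) = -(B x * ∑ i, σ i x • C i x))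
    (j : Fin k) {x : E} (hx : x ∈ U) :
    fderiv ℝ (fun y => fderiv ℝ B y (Y j y) + B y * C j y) x (∑ i, σ i x • Y i x) =
      -((fderiv ℝ B x (Y j x) + B x * C j x) * ∑ i, σ i x • C i x)
      + ∑ i, σ i x • ∑ l, c i j l • (fderiv ℝ B x (Y l x) + B x * C l x)
      - ∑ i, fderiv ℝ (σ i) x (Y j x) • (fderiv ℝ B x (Y i x) + B x * C i x) := by
  have hBx : ContDiffAt ℝ ∞ B x := hB.contDiffAt (hU.mem_nhds hx)
  have hB' : HasFDerivAt B (fderiv ℝ B x) x := (hBx.differentiableAt (by simp)).hasFDerivAt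
  have hB'' : HasFDerivAt (fderiv ℝ B) (fderiv ℝ (fderiv ℝ B) x) x :=
    ((hBx.fderiv_right (m := 1) (by norm_cast)).differentiableAt (by simp)).hasFDerivAt
  have hY' : ∀ i, HasFDerivAt (Y i) (fderiv ℝ (Y i) x) x := fun i =>
    ((hY i).differentiable (by simp) x).hasFDerivAt
  have hC' : ∀ i, HasFDerivAt (C i) (fderiv ℝ (C i) x) x := fun i =>
    ((hC i).differentiable (by simp) x).hasFDerivAt
  have hσ' : ∀ i, HasFDerivAt (σ i) (fderiv ℝ (σ i) x) x := fun i =>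
    (((hσ i).contDiffAt (hU.mem_nhds hx)).differentiableAt (by simp)).hasFDerivAt
  have hsymm : IsSymmSndFDerivAt ℝ B x :=
    hBx.isSymmSndFDerivAt (by simpa using WithTop.coe_le_coe.2 (le_top : (2 : ℕ∞) ≤ ⊤))
  have he := HasFDerivAt.fun_sum (u := Finset.univ) fun i _ => (hσ' i).fun_smul (hY' i)
  have hS := HasFDerivAt.fun_sum (u := Finset.univ) fun i _ => (hσ' i).fun_smul (hC' i)
  have h1 := hB''.clm_apply he
  have h2 := (hB'.fun_mul' hS).fun_neg
  have h3 : (fun y => fderiv ℝ B y (∑ i, σ i y • Y i y)) =ᶠ[nhds x]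
      fun y => -(B y * ∑ i, σ i y • C i y) := by
    filter_upwards [hU.mem_nhds hx] with y hy using hrad y hy
  have h4 := congrArg (fun L => L (Y j x)) ((h1.congr_of_eventuallyEq h3.symm).unique h2)
  have h5 := (hB''.clm_apply (hY' j)).fun_add (hB'.fun_mul' (hC' j))
  have hradx := hrad x hx
  rw [h5.fderiv]
  have h6 := hsymm (Y j x) (∑ i, σ i x • Y i x)
  set e := ∑ i, σ i x • Y i x with he_def
  set S := ∑ i, σ i x • C i x with hS_def
  simp only [add_apply, ContinuousLinearMap.comp_apply,
    ContinuousLinearMap.flip_apply, neg_apply, smul_apply,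
    sum_apply, ContinuousLinearMap.smulRight_apply, smul_eq_mul,
    MulOpposite.smul_eq_mul_unop, MulOpposite.unop_op] at h4 ⊢
  rw [h6] at h4
  have hX : fderiv ℝ (Y j) x e - ∑ i, (σ i x • fderiv ℝ (Y i) x (Y j x)
      + fderiv ℝ (σ i) x (Y j x) • Y i x)
      = ∑ i, σ i x • ∑ l, c i j l • Y l x - ∑ i, fderiv ℝ (σ i) x (Y j x) • Y i x := by
    rw [he_def, map_sum, Finset.sum_add_distrib, ← sub_sub, ← Finset.sum_sub_distrib]
    congr 1
    refine Finset.sum_congr rfl fun i _ => ?_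
    rw [map_smul, ← smul_sub, hbrY i j x hx]
  have hZ : fderiv ℝ (C j) x e - ∑ i, (σ i x • fderiv ℝ (C i) x (Y j x)
      + fderiv ℝ (σ i) x (Y j x) • C i x)
      = S * C j x - C j x * S + ∑ i, σ i x • ∑ l, c i j l • C l x
        - ∑ i, fderiv ℝ (σ i) x (Y j x) • C i x := by
    rw [he_def, map_sum, Finset.sum_add_distrib, ← sub_sub]
    congr 1
    rw [hS_def, Finset.sum_mul, Finset.mul_sum, ← Finset.sum_sub_distrib,
      ← Finset.sum_sub_distrib, ← Finset.sum_add_distrib]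
    refine Finset.sum_congr rfl fun i _ => ?_
    rw [map_smul, ← smul_sub, ← hbrC i j x hx, smul_mul_assoc, mul_smul_comm, ← smul_sub,
      ← smul_add, add_sub_cancel]
  have hP : ∑ i, σ i x • ∑ l, c i j l • (fderiv ℝ B x (Y l x) + B x * C l x) =
      fderiv ℝ B x (∑ i, σ i x • ∑ l, c i j l • Y l x)
        + B x * ∑ i, σ i x • ∑ l, c i j l • C l x := by
    simp only [map_sum, map_smul, Finset.mul_sum, mul_smul_comm, smul_add, Finset.sum_add_distrib]
  have hQ : ∑ i, fderiv ℝ (σ i) x (Y j x) • (fderiv ℝ B x (Y i x) + B x * C i x) =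
      fderiv ℝ B x (∑ i, fderiv ℝ (σ i) x (Y j x) • Y i x)
        + B x * ∑ i, fderiv ℝ (σ i) x (Y j x) • C i x := by
    simp only [map_sum, map_smul, Finset.mul_sum, mul_smul_comm, smul_add, Finset.sum_add_distrib]
  rw [sub_eq_iff_eq_add.1 hX, sub_eq_iff_eq_add.1 hZ, hP, hQ, hradx, map_add, map_sub,
    eq_sub_of_add_eq' h4]
  noncomm_ring

end FlatSections

section AdaptedChart

open Metric Set

theorem smul_fst_mem_ball_zero {P Q : Type*} [NormedAddCommGroup P] [NormedSpace ℝ P]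
    [NormedAddCommGroup Q] {r : ℝ} {q : P × Q} (hq : q ∈ ball (0 : P × Q) r) {t : ℝ}
    (ht : t ∈ Icc (0 : ℝ) 1) : (t • q.1, q.2) ∈ ball (0 : P × Q) r := by
  simp only [mem_ball_zero_iff, Prod.norm_def, sup_lt_iff, norm_smul] at hq ⊢
  refine ⟨lt_of_le_of_lt ?_ hq.1, hq.2⟩
  exact mul_le_of_le_one_left (norm_nonneg _) (by rw [Real.norm_of_nonneg ht.1]; exact ht.2)

variable {E A : Type} [NormedAddCommGroup E] [NormedSpace ℝ E] [FiniteDimensional ℝ E]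
  [NormedRing A] [NormedAlgebra ℝ A] [CompleteSpace A]

/-- Exponential coordinates along linearly independent vector fields `Y i`, with the solution `β`
of the radial part of `Y i (B) = -B * C i` normalised on the transversal. -/
theorem exists_adapted_chart {k : ℕ} {Y : Fin k → E → E} {C : Fin k → E → A}
    (hY : ∀ i, ContDiff ℝ ∞ (Y i)) (hC : ∀ i, ContDiff ℝ ∞ (C i)) {M : Set E} (hM : IsOpen M)
    {x₀ : E} (hx₀ : x₀ ∈ M) (hli : LinearIndependent ℝ fun i => Y i x₀) :
    ∃ (W : Submodule ℝ E) (r : ℝ) (φ : OpenPartialHomeomorph ((Fin k → ℝ) × W) E)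
      (β : (Fin k → ℝ) × W → A), 0 < r ∧ φ.source = ball 0 r ∧ φ.target ⊆ M ∧ φ 0 = x₀ ∧
      ContDiffOn ℝ ∞ φ φ.source ∧ ContDiffOn ℝ ∞ φ.symm φ.target ∧ ContDiffOn ℝ ∞ β φ.source ∧
      (∀ q ∈ φ.source, β (0, q.2) = 1) ∧
      (∀ q ∈ φ.source, ∀ s, fderiv ℝ φ (0, q.2) (s, 0) = ∑ i, s i • Y i (φ (0, q.2))) ∧
      ∀ q ∈ φ.source, ∀ t ∈ Icc (0 : ℝ) 1,
        fderiv ℝ φ (t • q.1, q.2) (q.1, 0) = ∑ i, q.1 i • Y i (φ (t • q.1, q.2)) ∧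
        fderiv ℝ β (t • q.1, q.2) (q.1, 0) =
          -(β (t • q.1, q.2) * ∑ i, q.1 i • C i (φ (t • q.1, q.2))) := by
  let F : (Fin k → ℝ) × (E × A) → E × A := fun p =>
    ∑ i, p.1 i • (Y i p.2.1, -(p.2.2 * C i p.2.1))
  have hF : ContDiff ℝ ∞ F := by fun_prop
  obtain ⟨r₀, hr₀, Ψ, hΨ, hΨ0, hΨd⟩ := exists_smooth_timeOne_flow F hF
    (fun t p x => by simp [F, Finset.smul_sum, mul_smul]) ((x₀, 1) : E × A)
  let e₁ : (Fin k → ℝ) →ₗ[ℝ] E := Fintype.linearCombination ℝ fun i => Y i x₀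
  have he₁ : Function.Injective e₁ := hli.fintypeLinearCombination_injective
  obtain ⟨W, hW⟩ := Submodule.exists_isCompl (LinearMap.range e₁)
  let e : ((Fin k → ℝ) × W) ≃L[ℝ] E :=
    (((LinearEquiv.ofInjective e₁ he₁).prodCongr (LinearEquiv.refl ℝ W)).trans
      (Submodule.prodEquivOfIsCompl _ _ hW)).toContinuousLinearEquiv
  have he : ∀ s w, e (s, w) = ∑ i, s i • Y i x₀ + w := fun s w => rfl
  let ζ : (Fin k → ℝ) × W → (Fin k → ℝ) × (E × A) := fun q => (q.1, (x₀ + q.2, 1))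
  have hζ : ∀ q, HasFDerivAt ζ ((ContinuousLinearMap.fst ℝ (Fin k → ℝ) W).prod
      ((W.subtypeL.comp (ContinuousLinearMap.snd ℝ (Fin k → ℝ) W)).prod 0)) q := fun q =>
    hasFDerivAt_fst.prodMk
      (((W.subtypeL.hasFDerivAt.comp q hasFDerivAt_snd).const_add x₀).prodMk
        (hasFDerivAt_const _ _))
  have hζs : ContDiff ℝ ∞ ζ :=
    contDiff_fst.prodMk ((contDiff_const.add (W.subtypeL.contDiff.comp contDiff_snd)).prodMk
      contDiff_const)
  have hζm : MapsTo ζ (ball 0 r₀) (ball (0, (x₀, 1)) r₀) := by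
    intro q hq
    simpa [ζ, Prod.dist_eq, Prod.norm_def, hr₀, dist_eq_norm] using hq
  let G := Ψ ∘ ζ
  have hG : ContDiffOn ℝ ∞ G (ball 0 r₀) := hΨ.comp hζs.contDiffOn hζm
  have hGd : ∀ q ∈ ball (0 : (Fin k → ℝ) × W) r₀, HasFDerivAt G (fderiv ℝ G q) q := fun q hq =>
    ((hG.contDiffAt (isOpen_ball.mem_nhds hq)).differentiableAt (by simp)).hasFDerivAt
  have hscale : ∀ q ∈ ball (0 : (Fin k → ℝ) × W) r₀, ∀ t ∈ Icc (0 : ℝ) 1,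
      (t • q.1, q.2) ∈ ball (0 : (Fin k → ℝ) × W) r₀ :=
    fun _ hq _ ht => smul_fst_mem_ball_zero hq ht
  have hGr : ∀ q ∈ ball (0 : (Fin k → ℝ) × W) r₀, ∀ t ∈ Icc (0 : ℝ) 1,
      fderiv ℝ G (t • q.1, q.2) (q.1, 0) = F (q.1, G (t • q.1, q.2)) := by
    intro q hq t ht
    have h1 := hΨd (ζ q) (hζm hq) t ht
    have hΨ' : DifferentiableAt ℝ Ψ (ζ (t • q.1, q.2)) :=
      (hΨ.contDiffAt (isOpen_ball.mem_nhds (hζm (hscale q hq t ht)))).differentiableAt (by simp)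
    rw [(hΨ'.hasFDerivAt.comp _ (hζ _)).fderiv]
    simpa [ζ, G, Prod.mk_zero_zero] using h1
  have hG0 : ∀ q ∈ ball (0 : (Fin k → ℝ) × W) r₀, G (0, q.2) = (x₀ + q.2, 1) := fun q hq =>
    hΨ0 (ζ q) (hζm hq)
  have hGs : ∀ q ∈ ball (0 : (Fin k → ℝ) × W) r₀, ∀ s,
      fderiv ℝ G (0, q.2) (s, 0) = F (s, G (0, q.2)) := by
    intro q hq s
    have hε : 0 < r₀ / (‖s‖ + 1) := by positivity
    have hq' : (((r₀ / (‖s‖ + 1)) • s, q.2) : (Fin k → ℝ) × W) ∈ ball 0 r₀ := by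
      simp only [mem_ball_zero_iff, Prod.norm_def, sup_lt_iff, norm_smul] at hq ⊢
      refine ⟨?_, hq.2⟩
      rw [Real.norm_of_nonneg hε.le, div_mul_eq_mul_div, div_lt_iff₀ (by positivity)]
      nlinarith
    have h1 := hGr _ hq' 0 (by simp)
    have h2 : (((r₀ / (‖s‖ + 1)) • s, 0) : (Fin k → ℝ) × W) = (r₀ / (‖s‖ + 1)) • (s, 0) := by simp
    have h3 : F ((r₀ / (‖s‖ + 1)) • s, G (0, q.2)) = (r₀ / (‖s‖ + 1)) • F (s, G (0, q.2)) := by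
      simp [F, Finset.smul_sum, mul_smul]
    simp only [zero_smul] at h1
    rw [h2, map_smul, h3] at h1
    exact smul_right_injective _ hε.ne' h1
  let Φ : (Fin k → ℝ) × W → E := fun q => (G q).1
  let β : (Fin k → ℝ) × W → A := fun q => (G q).2
  have hΦd : ∀ q ∈ ball (0 : (Fin k → ℝ) × W) r₀, HasFDerivAt Φ
      ((ContinuousLinearMap.fst ℝ E A).comp (fderiv ℝ G q)) q := fun q hq => (hGd q hq).fst
  have hβd : ∀ q ∈ ball (0 : (Fin k → ℝ) × W) r₀, HasFDerivAt β
      ((ContinuousLinearMap.snd ℝ E A).comp (fderiv ℝ G q)) q := fun q hq => (hGd q hq).snd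
  have h0 : (0 : (Fin k → ℝ) × W) ∈ ball (0 : (Fin k → ℝ) × W) r₀ := mem_ball_self hr₀
  have hF1 : ∀ p, (F p).1 = ∑ i, p.1 i • Y i p.2.1 := fun p => by simp [F, Prod.fst_sum]
  have hF2 : ∀ p, (F p).2 = -(p.2.2 * ∑ i, p.1 i • C i p.2.1) := fun p => by
    simp [F, Prod.snd_sum, Finset.mul_sum]
  have hΦe : HasFDerivAt Φ (e : ((Fin k → ℝ) × W) →L[ℝ] E) 0 := by
    convert hΦd 0 h0 using 1
    ext1 <;> ext1 v
    · have := hGs 0 h0 v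
      simp only [Prod.snd_zero] at this
      simp only [ContinuousLinearMap.comp_apply, ContinuousLinearMap.inl_apply,
        ContinuousLinearEquiv.coe_coe, he, ContinuousLinearMap.coe_fst']
      rw [← Prod.zero_eq_mk] at this
      rw [this, hF1]
      have h4 := hG0 0 h0
      simp only [Prod.snd_zero, ← Prod.zero_eq_mk] at h4
      simp [h4]
    · have h5 : HasFDerivAt (fun w : W => Φ (0, w))
          (((ContinuousLinearMap.fst ℝ E A).comp (fderiv ℝ G 0)).comp
            (ContinuousLinearMap.inr ℝ (Fin k → ℝ) W)) 0 :=
        HasFDerivAt.comp (0 : W) (hΦd 0 h0) (ContinuousLinearMap.inr ℝ (Fin k → ℝ) W).hasFDerivAt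
      have h6 : (fun w : W => Φ (0, w)) =ᶠ[nhds 0] fun w => x₀ + w := by
        filter_upwards [ball_mem_nhds (0 : W) hr₀] with w hw
        have := hG0 (0, w) (by simpa [Prod.norm_def, hr₀] using hw)
        simp only [Φ, this]
      have h7 := h5.unique
        ((W.subtypeL.hasFDerivAt.const_add x₀).congr_of_eventuallyEq h6)
      have h8 := congrArg (fun L => L v) h7
      simp only [ContinuousLinearMap.comp_apply] at h8 ⊢
      rw [h8]
      simp [he]
  obtain ⟨φ₀, hφ0, hφs, hφΦ, hφsymm⟩ :=
    hG.fst.exists_smooth_local_inverse isOpen_ball h0 e hΦe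
  have hΦ0 : Φ 0 = x₀ := by
    have h4 := hG0 0 h0
    simp only [Prod.snd_zero, ← Prod.zero_eq_mk] at h4
    simp [Φ, h4]
  have hnhds : φ₀.source ∩ φ₀ ⁻¹' M ∈ nhds (0 : (Fin k → ℝ) × W) := by
    refine (φ₀.isOpen_inter_preimage hM).mem_nhds ⟨hφ0, ?_⟩
    rw [mem_preimage, hφΦ]
    exact (congrArg (· ∈ M) hΦ0).mpr hx₀
  obtain ⟨r, hr, hrs⟩ := Metric.mem_nhds_iff.1 hnhds
  let φ := φ₀.restrOpen (ball 0 r) isOpen_ball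
  have hφsrc : φ.source = ball 0 r := inter_eq_right.2 fun q hq => (hrs hq).1
  have hsub : φ.source ⊆ ball 0 r₀ := inter_subset_left.trans hφs
  have hcoe : (φ : (Fin k → ℝ) × W → E) = Φ := hφΦ
  have hzero : ∀ q ∈ ball (0 : (Fin k → ℝ) × W) r₀,
      (0, q.2) ∈ ball (0 : (Fin k → ℝ) × W) r₀ := fun q hq => by
    simpa using hscale q hq 0 (by simp)
  refine ⟨W, r, φ, β, hr, hφsrc, ?_, hcoe ▸ hΦ0, ?_, hφsymm.mono ?_, hG.snd.mono hsub, ?_, ?_, ?_⟩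
  · intro x hx
    have := (hrs (hφsrc ▸ φ.map_target hx)).2
    rwa [mem_preimage, show φ₀ (φ.symm x) = x from φ.right_inv hx] at this
  · rw [hcoe]
    exact hG.fst.mono hsub
  · exact inter_subset_left
  · intro q hq
    simp only [β, hG0 q (hsub hq)]
  · intro q hq s
    rw [hcoe, (hΦd _ (hzero q (hsub hq))).fderiv, ContinuousLinearMap.comp_apply,
      hGs q (hsub hq)]
    exact hF1 _
  · intro q hq t ht
    have hmem := hscale q (hsub hq) t ht
    rw [hcoe, (hΦd _ hmem).fderiv, (hβd _ hmem).fderiv, ContinuousLinearMap.comp_apply,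
      ContinuousLinearMap.comp_apply, hGr q (hsub hq) t ht]
    exact ⟨hF1 _, hF2 _⟩

end AdaptedChart

section FlatSectionExistence

open Metric Set

variable {E A : Type} [NormedAddCommGroup E] [NormedSpace ℝ E] [FiniteDimensional ℝ E]
  [NormedRing A] [NormedAlgebra ℝ A] [CompleteSpace A]

/-- The system `Y i (B) = -B * C i` has a local solution with `B x₀ = 1`, as soon as it is formally
integrable. Every point of the domain is reached, from a point where `B = 1`, by an integral curve
of a constant linear combination of the `Y i`. -/
theorem exists_flat_section {k : ℕ} {Y : Fin k → E → E} {C : Fin k → E → A}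
    {c : Fin k → Fin k → Fin k → ℝ}
    (hY : ∀ i, ContDiff ℝ ∞ (Y i)) (hC : ∀ i, ContDiff ℝ ∞ (C i)) {M : Set E} (hM : IsOpen M)
    (hbrY : ∀ i j, ∀ x ∈ M,
      fderiv ℝ (Y j) x (Y i x) - fderiv ℝ (Y i) x (Y j x) = ∑ l, c i j l • Y l x)
    (hbrC : ∀ i j, ∀ x ∈ M,
      fderiv ℝ (C j) x (Y i x) - fderiv ℝ (C i) x (Y j x) - (C i x * C j x - C j x * C i x)
        = ∑ l, c i j l • C l x)
    {x₀ : E} (hx₀ : x₀ ∈ M) (hli : LinearIndependent ℝ fun i => Y i x₀) :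
    ∃ (U : Set E) (B : E → A), IsOpen U ∧ x₀ ∈ U ∧ U ⊆ M ∧ ContDiffOn ℝ ∞ B U ∧ B x₀ = 1 ∧
      (∀ i, ∀ x ∈ U, fderiv ℝ B x (Y i x) = -(B x * C i x)) ∧
      ∀ x ∈ U, ∃ (γ : ℝ → E) (s : Fin k → ℝ), B (γ 0) = 1 ∧ γ 1 = x ∧
        ∀ t ∈ Icc (0 : ℝ) 1, γ t ∈ U ∧ HasDerivAt γ (∑ i, s i • Y i (γ t)) t := by
  obtain ⟨W, r, φ, β, hr, hsrc, htgt, hφ0, hφ, hψ, hβ, hβ0, hφs, hrad⟩ :=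
    exists_adapted_chart hY hC hM hx₀ hli
  let σ : Fin k → E → ℝ := fun i x => (φ.symm x).1 i
  let B : E → A := β ∘ φ.symm
  have h0 : (0 : (Fin k → ℝ) × W) ∈ φ.source := hsrc ▸ mem_ball_self hr
  have hscale : ∀ q ∈ φ.source, ∀ t ∈ Icc (0 : ℝ) 1, (t • q.1, q.2) ∈ φ.source := by
    rw [hsrc]
    exact fun q hq t ht => smul_fst_mem_ball_zero hq ht
  have hφd : ∀ q ∈ φ.source, HasFDerivAt φ (fderiv ℝ φ q) q := fun q hq =>
    ((hφ.contDiffAt (φ.open_source.mem_nhds hq)).differentiableAt (by simp)).hasFDerivAt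
  have hψd : ∀ x ∈ φ.target, HasFDerivAt φ.symm (fderiv ℝ φ.symm x) x := fun x hx =>
    ((hψ.contDiffAt (φ.open_target.mem_nhds hx)).differentiableAt (by simp)).hasFDerivAt
  have hβd : ∀ q ∈ φ.source, HasFDerivAt β (fderiv ℝ β q) q := fun q hq =>
    ((hβ.contDiffAt (φ.open_source.mem_nhds hq)).differentiableAt (by simp)).hasFDerivAt
  have hinv : ∀ q ∈ φ.source, ∀ v, fderiv ℝ φ.symm (φ q) (fderiv ℝ φ q v) = v := by
    intro q hq v
    have h1 := (hψd _ (φ.map_source hq)).comp q (hφd q hq)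
    have h2 : (φ.symm ∘ φ) =ᶠ[nhds q] id := by
      filter_upwards [φ.open_source.mem_nhds hq] with y hy using φ.left_inv hy
    exact congrArg (fun L => L v) (h1.unique ((hasFDerivAt_id q).congr_of_eventuallyEq h2))
  have hB : ContDiffOn ℝ ∞ B φ.target := hβ.comp hψ φ.mapsTo_symm
  have hσ : ∀ i, ContDiffOn ℝ ∞ (σ i) φ.target := fun i =>
    contDiffOn_pi.1 hψ.fst i
  have hσd : ∀ i, ∀ q ∈ φ.source, ∀ v,
      fderiv ℝ (σ i) (φ q) (fderiv ℝ φ q v) = v.1 i := by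
    intro i q hq v
    have h1 := hasFDerivAt_pi'.1 (hψd _ (φ.map_source hq)).fst i
    rw [show fderiv ℝ (σ i) (φ q) = _ from h1.fderiv]
    simp [hinv q hq v]
  have hBrad : ∀ x ∈ φ.target,
      fderiv ℝ B x (∑ i, σ i x • Y i x) = -(B x * ∑ i, σ i x • C i x) := by
    intro x hx
    have hq := φ.map_target hx
    have h1 := hrad _ hq 1 (by simp)
    simp only [one_smul, Prod.mk.eta, φ.right_inv hx] at h1
    have h2 := hinv _ hq ((φ.symm x).1, 0)
    rw [φ.right_inv hx, h1.1] at h2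
    rw [((hβd _ hq).comp x (hψd x hx)).fderiv, ContinuousLinearMap.comp_apply, h2]
    exact h1.2
  let R : Fin k → E → A := fun j y => fderiv ℝ B y (Y j y) + B y * C j y
  have hR : ∀ j, ContDiffOn ℝ ∞ (R j) φ.target := fun j =>
    ((hB.fderiv_of_isOpen φ.open_target (m := ∞) (by simp)).clm_apply (hY j).contDiffOn).add
      (hB.mul (hC j).contDiffOn)
  have hcurve : ∀ x ∈ φ.target, ∀ t ∈ Icc (0 : ℝ) 1,
      HasDerivAt (fun t : ℝ => φ (t • (φ.symm x).1, (φ.symm x).2))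
        (∑ i, (φ.symm x).1 i • Y i (φ (t • (φ.symm x).1, (φ.symm x).2))) t := by
    intro x hx t ht
    rw [← (hrad _ (φ.map_target hx) t ht).1]
    have h1 : HasDerivAt (fun t : ℝ => (t • (φ.symm x).1, (φ.symm x).2)) ((φ.symm x).1, 0) t := by
      simpa using ((hasDerivAt_id t).smul_const (φ.symm x).1).prodMk
        (hasDerivAt_const t (φ.symm x).2)
    exact (hφd _ (hscale _ (φ.map_target hx) t ht)).comp_hasDerivAt t h1
  refine ⟨φ.target, B, φ.open_target, hφ0 ▸ φ.map_source h0, htgt, hB, ?_, ?_, ?_⟩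
  · rw [← hφ0]
    simpa [B, φ.left_inv h0, Prod.mk_zero_zero] using hβ0 0 h0
  · suffices h : ∀ x ∈ φ.target, (fun j => R j x) = 0 from fun j x hx =>
      eq_neg_of_add_eq_zero_left (congrFun (h x hx) j)
    intro x hx
    have hq := φ.map_target hx
    set s := (φ.symm x).1
    set w := (φ.symm x).2
    let γ : ℝ → E := fun t => φ (t • s, w)
    have hγ : ∀ t ∈ Icc (0 : ℝ) 1, HasDerivAt γ (∑ i, s i • Y i (γ t)) t := hcurve x hx
    have hmaps : MapsTo γ (Icc 0 1) φ.target := fun t ht => φ.map_source (hscale _ hq t ht)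
    have hγs : ContDiffOn ℝ ∞ γ (Icc 0 1) :=
      hφ.comp (ContDiff.contDiffOn (by fun_prop)) fun t ht => hscale _ hq t ht
    have hσγ : ∀ t ∈ Icc (0 : ℝ) 1, ∀ i, σ i (γ t) = t * s i := by
      intro t ht i
      have h1 : φ.symm (γ t) = (t • s, w) := φ.left_inv (hscale _ hq t ht)
      simp only [σ, h1, Pi.smul_apply, smul_eq_mul]
    let ρ : Fin k → Fin k → ℝ → ℝ := fun i j t =>
      fderiv ℝ (σ i) (γ t) (Y j (γ t)) - if i = j then 1 else 0
    have hρ0 : ∀ i j, ρ i j 0 = 0 := by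
      intro i j
      have h1 := hφs _ hq (Pi.single j 1)
      simp only [Pi.single_apply, ite_smul, one_smul, zero_smul, Finset.sum_ite_eq',
        Finset.mem_univ, if_true] at h1
      have h2 := hscale _ hq 0 (by simp)
      have h3 := hσd i _ h2 (Pi.single j 1, 0)
      simp only [zero_smul] at h3
      rw [h1] at h3
      simp only [ρ, γ, zero_smul]
      rw [h3, Pi.single_apply, sub_self]
    have hρs : ∀ i j, ContDiffOn ℝ ∞ (ρ i j) (Icc 0 1) := fun i j =>
      (((((hσ i).fderiv_of_isOpen φ.open_target (m := ∞) (by simp)).clm_apply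
        (hY j).contDiffOn).comp hγs hmaps)).sub contDiffOn_const
    have hρ : ∀ i j, ∃ K : ℝ, 0 ≤ K ∧ ∀ t ∈ Icc (0 : ℝ) 1, ‖ρ i j t‖ ≤ K * t := by
      intro i j
      obtain ⟨K, hK⟩ := (hρs i j).exists_lipschitzOnWith (by simp) (convex_Icc 0 1) isCompact_Icc
      refine ⟨K, K.2, fun t ht => ?_⟩
      simpa [hρ0, dist_eq_norm, Real.norm_of_nonneg ht.1, abs_of_nonneg ht.1] using
        hK.dist_le_mul t ht 0 (by simp)
    choose K hK0 hK using hρ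
    obtain ⟨K₂, hK₂⟩ := isCompact_Icc.exists_bound_of_continuousOn
      (f := fun t => ∑ i, s i • C i (γ t)) (s := Icc (0 : ℝ) 1)
      (continuousOn_finsetSum _ fun i _ =>
        ((hC i).continuous.comp_continuousOn hγs.continuousOn).const_smul (s i))
    have hK₂0 : 0 ≤ K₂ := (norm_nonneg _).trans (hK₂ 0 (by simp))
    let κ : Fin k → ℝ := fun j => K₂ + ∑ i, |s i| * ∑ l, |c i j l| + ∑ i, K i j
    have hκ : ∀ j, 0 ≤ κ j := fun j => by
      have := Finset.sum_nonneg fun i (_ : i ∈ Finset.univ) => hK0 i j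
      positivity
    have h1 : γ 1 = x := by simp [γ, s, w, φ.right_inv hx]
    rw [← h1]
    refine eq_zero_of_norm_smul_deriv_add_le (K := ∑ j, κ j) (r := fun t j => R j (γ t))
      (r' := fun t j => fderiv ℝ (R j) (γ t) (∑ i, s i • Y i (γ t))) ?_ ?_
    · intro t ht
      refine hasDerivAt_pi.2 fun j => ?_
      exact (((hR j).contDiffAt (φ.open_target.mem_nhds (hmaps ht))).differentiableAt
        (by simp)).hasFDerivAt.comp_hasDerivAt t (hγ t ht)
    · intro t ht
      have hnn := mul_nonneg ht.1 (norm_nonneg fun j => R j (γ t))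
      rw [pi_norm_le_iff_of_nonneg
        (mul_nonneg (Finset.sum_nonneg fun j _ => hκ j) hnn)]
      intro j
      refine le_trans ?_ (mul_le_mul_of_nonneg_right
        (Finset.single_le_sum (fun j _ => hκ j) (Finset.mem_univ j)) hnn)
      have h2 := fderiv_flatness_defect_radial φ.open_target hY hC hB hσ
        (fun i j x hx => hbrY i j x (htgt hx)) (fun i j x hx => hbrC i j x (htgt hx)) hBrad j
        (hmaps ht)
      simp only [hσγ t ht, mul_smul, ← Finset.smul_sum, map_smul] at h2
      have h3 : t • fderiv ℝ (R j) (γ t) (∑ i, s i • Y i (γ t)) + R j (γ t) =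
          -(R j (γ t) * t • ∑ i, s i • C i (γ t)) + t • ∑ i, s i • ∑ l, c i j l • R l (γ t)
          - ∑ i, ρ i j t • R i (γ t) := by
        rw [show t • fderiv ℝ (R j) (γ t) (∑ i, s i • Y i (γ t)) = _ from h2]
        simp only [ρ, sub_smul, Finset.sum_sub_distrib, ite_smul, one_smul, zero_smul,
          Finset.sum_ite_eq', Finset.mem_univ, if_true, R]
        abel
      have hr : ∀ i, ‖R i (γ t)‖ ≤ ‖fun j => R j (γ t)‖ := fun i =>
        norm_le_pi_norm (fun j => R j (γ t)) i
      simp only [Pi.add_apply, Pi.smul_apply]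
      rw [h3]
      set N := ‖fun j => R j (γ t)‖
      have hN : 0 ≤ N := norm_nonneg _
      have e1 : ‖R j (γ t) * t • ∑ i, s i • C i (γ t)‖ ≤ K₂ * (t * N) := by
        rw [mul_smul_comm, norm_smul, Real.norm_of_nonneg ht.1]
        calc t * ‖R j (γ t) * ∑ i, s i • C i (γ t)‖ ≤ t * (N * K₂) := by
              refine mul_le_mul_of_nonneg_left ((norm_mul_le _ _).trans ?_) ht.1
              exact mul_le_mul (hr j) (hK₂ t ht) (norm_nonneg _) hN
          _ = K₂ * (t * N) := by ring
      have e2 : ‖t • ∑ i, s i • ∑ l, c i j l • R l (γ t)‖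
          ≤ (∑ i, |s i| * ∑ l, |c i j l|) * (t * N) := by
        rw [norm_smul, Real.norm_of_nonneg ht.1, mul_left_comm]
        refine mul_le_mul_of_nonneg_left ?_ ht.1
        rw [Finset.sum_mul]
        refine norm_sum_le_of_le _ fun i _ => ?_
        rw [norm_smul, mul_assoc, Real.norm_eq_abs]
        refine mul_le_mul_of_nonneg_left ?_ (abs_nonneg _)
        rw [Finset.sum_mul]
        refine norm_sum_le_of_le _ fun l _ => ?_
        rw [norm_smul, Real.norm_eq_abs]
        exact mul_le_mul_of_nonneg_left (hr l) (abs_nonneg _)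
      have e3 : ‖∑ i, ρ i j t • R i (γ t)‖ ≤ (∑ i, K i j) * (t * N) := by
        rw [Finset.sum_mul]
        refine norm_sum_le_of_le _ fun i _ => ?_
        rw [norm_smul, ← mul_assoc]
        exact mul_le_mul (hK i j t ht) (hr i) (norm_nonneg _) (mul_nonneg (hK0 i j) ht.1)
      calc _ ≤ _ := (norm_sub_le _ _).trans (add_le_add_left (norm_add_le _ _) _)
        _ ≤ κ j * (t * N) := by
          rw [norm_neg]
          simp only [κ, add_mul]
          gcongr
  · intro x hx
    refine ⟨fun t => φ (t • (φ.symm x).1, (φ.symm x).2), (φ.symm x).1, ?_, ?_, fun t ht =>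
      ⟨φ.map_source (hscale _ (φ.map_target hx) t ht), hcurve x hx t ht⟩⟩
    · have h1 := hscale _ (φ.map_target hx) 0 (by simp)
      simp only [B, Function.comp_apply, φ.left_inv h1]
      simpa using hβ0 _ (φ.map_target hx)
    · simp [φ.right_inv hx]

end FlatSectionExistence

section Conversion

theorem vfApp_eq_fderiv {d : ℕ} (Y : (Fin d → ℝ) → Fin d → ℝ) (f : (Fin d → ℝ) → ℝ)
    (x : Fin d → ℝ) : vfApp Y f x = fderiv ℝ f x (Y x) := by
  conv_rhs => rw [← Finset.univ_sum_single (Y x), map_sum]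
  refine Finset.sum_congr rfl fun k _ => ?_
  rw [pd, ← smul_eq_mul, ← map_smul, ← Pi.single_smul, smul_eq_mul, mul_one]

theorem vfBracket_eq_fderiv_sub {d : ℕ} {X Y : (Fin d → ℝ) → Fin d → ℝ} {x : Fin d → ℝ}
    (hX : DifferentiableAt ℝ X x) (hY : DifferentiableAt ℝ Y x) :
    vfBracket X Y x = fderiv ℝ Y x (X x) - fderiv ℝ X x (Y x) := by
  have h : ∀ {Z : (Fin d → ℝ) → Fin d → ℝ}, DifferentiableAt ℝ Z x → ∀ i v,
      fderiv ℝ (fun y => Z y i) x v = fderiv ℝ Z x v i := fun hZ i v => by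
    rw [(hasFDerivAt_pi'.1 hZ.hasFDerivAt i).fderiv]
    rfl
  ext i
  rw [Pi.sub_apply, ← h hX, ← h hY, ← vfApp_eq_fderiv, ← vfApp_eq_fderiv]
  exact Finset.sum_sub_distrib _ _

end Conversion

section LocalFlatSection

open Set

variable {E A : Type} [NormedAddCommGroup E] [NormedSpace ℝ E] [FiniteDimensional ℝ E]
  [NormedRing A] [NormedAlgebra ℝ A] [CompleteSpace A]

theorem exists_flat_section_of_contDiffOn {k : ℕ} {Y : Fin k → E → E} {C : Fin k → E → A}
    {c : Fin k → Fin k → Fin k → ℝ} {M : Set E} (hM : IsOpen M)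
    (hY : ∀ i, ContDiffOn ℝ ∞ (Y i) M) (hC : ∀ i, ContDiffOn ℝ ∞ (C i) M)
    (hbrY : ∀ i j, ∀ x ∈ M,
      fderiv ℝ (Y j) x (Y i x) - fderiv ℝ (Y i) x (Y j x) = ∑ l, c i j l • Y l x)
    (hbrC : ∀ i j, ∀ x ∈ M,
      fderiv ℝ (C j) x (Y i x) - fderiv ℝ (C i) x (Y j x) - (C i x * C j x - C j x * C i x)
        = ∑ l, c i j l • C l x)
    {x₀ : E} (hx₀ : x₀ ∈ M) (hli : LinearIndependent ℝ fun i => Y i x₀) :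
    ∃ (U : Set E) (B : E → A), IsOpen U ∧ x₀ ∈ U ∧ U ⊆ M ∧ ContDiffOn ℝ ∞ B U ∧ B x₀ = 1 ∧
      (∀ i, ∀ x ∈ U, fderiv ℝ B x (Y i x) = -(B x * C i x)) ∧
      ∀ x ∈ U, ∃ (γ : ℝ → E) (s : Fin k → ℝ), B (γ 0) = 1 ∧ γ 1 = x ∧
        ∀ t ∈ Icc (0 : ℝ) 1, γ t ∈ U ∧ HasDerivAt γ (∑ i, s i • Y i (γ t)) t := by
  choose Y' hY' hYY' using fun i => (hY i).exists_contDiff_eventuallyEq hM hx₀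
  choose C' hC' hCC' using fun i => (hC i).exists_contDiff_eventuallyEq hM hx₀
  obtain ⟨N, hN, hNo, hxN⟩ := eventually_nhds_iff.1
    (((Filter.eventually_all.2 hYY').and (Filter.eventually_all.2 hCC')).and (hM.mem_nhds hx₀))
  have hNY : ∀ i, ∀ x ∈ N, Y' i x = Y i x := fun i x hx => (hN x hx).1.1 i
  have hNC : ∀ i, ∀ x ∈ N, C' i x = C i x := fun i x hx => (hN x hx).1.2 i
  have hfY : ∀ i, ∀ x ∈ N, fderiv ℝ (Y' i) x = fderiv ℝ (Y i) x := fun i x hx =>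
    Filter.EventuallyEq.fderiv_eq (Filter.eventually_of_mem (hNo.mem_nhds hx) (hNY i))
  have hfC : ∀ i, ∀ x ∈ N, fderiv ℝ (C' i) x = fderiv ℝ (C i) x := fun i x hx =>
    Filter.EventuallyEq.fderiv_eq (Filter.eventually_of_mem (hNo.mem_nhds hx) (hNC i))
  obtain ⟨U, B, hU, hxU, hUN, hB, hB1, hBC, hγ⟩ := exists_flat_section (c := c) hY' hC' hNo
    (fun i j x hx => by simpa only [hfY _ x hx, hNY _ x hx] using hbrY i j x (hN x hx).2)
    (fun i j x hx => by
      simpa only [hfC _ x hx, hNY _ x hx, hNC _ x hx] using hbrC i j x (hN x hx).2)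
    hxN (by simpa only [hNY _ x₀ hxN] using hli)
  refine ⟨U, B, hU, hxU, fun x hx => (hN x (hUN hx)).2, hB, hB1, fun i x hx => ?_, fun x hx => ?_⟩
  · rw [← hNY i x (hUN hx), ← hNC i x (hUN hx)]
    exact hBC i x hx
  · obtain ⟨γ, s, h0, h1, hd⟩ := hγ x hx
    refine ⟨γ, s, h0, h1, fun t ht => ⟨(hd t ht).1, ?_⟩⟩
    simpa only [hNY _ _ (hUN (hd t ht).1)] using (hd t ht).2

end LocalFlatSection

section Matrix

open Set
open scoped Matrix Matrix.Norms.Operator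

theorem fderiv_matrix_apply {E : Type*} [NormedAddCommGroup E] [NormedSpace ℝ E] {m n : Type*}
    [Fintype m] [Fintype n] {f : E → Matrix m n ℝ} {x : E} (hf : DifferentiableAt ℝ f x)
    (a : m) (b : n) (v : E) : fderiv ℝ (fun y => f y a b) x v = fderiv ℝ f x v a b := by
  let ℓ := LinearMap.toContinuousLinearMap (Matrix.entryLinearMap ℝ ℝ a b)
  have h := (ℓ.hasFDerivAt.comp x hf.hasFDerivAt).fderiv
  exact congrArg (fun L => L v) h

theorem mul_transpose_eq_one_of_hasDerivAt {m : ℕ} {b D : ℝ → Matrix (Fin m) (Fin m) ℝ}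
    (h0 : b 0 = 1) (hD : ∀ t ∈ Icc (0 : ℝ) 1, (D t)ᵀ = -D t)
    (hb : ∀ t ∈ Icc (0 : ℝ) 1, HasDerivAt b (-(b t * D t)) t) : b 1 * (b 1)ᵀ = 1 := by
  let T := LinearMap.toContinuousLinearMap
    (Matrix.transposeLinearEquiv (Fin m) (Fin m) ℝ ℝ).toLinearMap
  have hd : ∀ t ∈ Icc (0 : ℝ) 1, HasDerivAt (fun t => b t * (b t)ᵀ) 0 t := by
    intro t ht
    have h1 : HasDerivAt (fun t => (b t)ᵀ) (-(b t * D t))ᵀ t :=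
      T.hasFDerivAt.comp_hasDerivAt t (hb t ht)
    refine ((hb t ht).fun_mul h1).congr_deriv ?_
    rw [Matrix.transpose_neg, Matrix.transpose_mul, hD t ht]
    noncomm_ring
  have h := constant_of_has_deriv_right_zero
    (fun t ht => (hd t ht).continuousAt.continuousWithinAt)
    (fun t ht => (hd t (Ico_subset_Icc_self ht)).hasDerivWithinAt) 1 (by simp)
  simpa [h0] using h

end Matrix

section SpecialOrthogonal

open Set
open scoped Matrix Matrix.Norms.Operator

/-- For antisymmetric `C i`, the equations `Y i (B) = -B * C i` have a local solution in `SO(m)`. -/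
theorem exists_specialOrthogonal_flat_section {m k : ℕ} {E : Type} [NormedAddCommGroup E]
    [NormedSpace ℝ E] [FiniteDimensional ℝ E] {Y : Fin k → E → E}
    {C : Fin k → E → Matrix (Fin m) (Fin m) ℝ} {c : Fin k → Fin k → Fin k → ℝ} {M : Set E}
    (hM : IsOpen M) (hY : ∀ i, ContDiffOn ℝ ∞ (Y i) M) (hC : ∀ i, ContDiffOn ℝ ∞ (C i) M)
    (hCso : ∀ i, ∀ x ∈ M, (C i x)ᵀ = -C i x)
    (hbrY : ∀ i j, ∀ x ∈ M,
      fderiv ℝ (Y j) x (Y i x) - fderiv ℝ (Y i) x (Y j x) = ∑ l, c i j l • Y l x)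
    (hbrC : ∀ i j, ∀ x ∈ M,
      fderiv ℝ (C j) x (Y i x) - fderiv ℝ (C i) x (Y j x) - (C i x * C j x - C j x * C i x)
        = ∑ l, c i j l • C l x)
    {x₀ : E} (hx₀ : x₀ ∈ M) (hli : LinearIndependent ℝ fun i => Y i x₀) :
    ∃ (U : Set E) (B : E → Matrix (Fin m) (Fin m) ℝ), IsOpen U ∧ x₀ ∈ U ∧ U ⊆ M ∧
      ContDiffOn ℝ ∞ B U ∧ (∀ x ∈ U, B x * (B x)ᵀ = 1) ∧ (∀ x ∈ U, (B x).det = 1) ∧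
      ∀ i, ∀ x ∈ U, fderiv ℝ B x (Y i x) = -(B x * C i x) := by
  obtain ⟨U, B, hU, hxU, hUM, hB, hB1, hBC, hγ⟩ :=
    exists_flat_section_of_contDiffOn hM hY hC hbrY hbrC hx₀ hli
  have horth : ∀ x ∈ U, B x * (B x)ᵀ = 1 := by
    intro x hx
    obtain ⟨γ, s, h0, h1, hd⟩ := hγ x hx
    rw [← h1]
    refine mul_transpose_eq_one_of_hasDerivAt (b := B ∘ γ) (D := fun t => ∑ i, s i • C i (γ t))
      h0 (fun t ht => ?_) fun t ht => ?_
    · simp only [Matrix.transpose_sum, Matrix.transpose_smul, hCso _ _ (hUM (hd t ht).1), smul_neg,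
        Finset.sum_neg_distrib]
    · have hBd := ((hB.contDiffAt (hU.mem_nhds (hd t ht).1)).differentiableAt
        (by simp)).hasFDerivAt
      refine (hBd.comp_hasDerivAt t (hd t ht).2).congr_deriv ?_
      simp only [map_sum, map_smul, hBC _ _ (hd t ht).1, Function.comp_apply, Finset.mul_sum,
        mul_smul_comm, smul_neg, Finset.sum_neg_distrib]
  have hdet : ContinuousOn (fun x => (B x).det) U :=
    continuous_id.matrix_det.comp_continuousOn hB.continuousOn
  refine ⟨U ∩ (fun x => (B x).det) ⁻¹' Ioi 0, B, hdet.isOpen_inter_preimage hU isOpen_Ioi,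
    ⟨hxU, by simp [hB1]⟩, inter_subset_left.trans hUM, hB.mono inter_subset_left,
    fun x hx => horth x hx.1, fun x hx => ?_, fun i x hx => hBC i x hx.1⟩
  have h1 := congrArg Matrix.det (horth x hx.1)
  rw [Matrix.det_mul, Matrix.det_transpose, Matrix.det_one, mul_self_eq_one_iff] at h1
  have h2 : 0 < (B x).det := hx.2
  exact h1.resolve_right fun h => by linarith

end SpecialOrthogonal

/-- Theorem 3.4.  If `V_1 = (Y_1,C_1,τ_1),…,V_k = (Y_k,C_k,τ_k)` span a Lie
algebra of infinitesimal stochastic transformations and `Y_1(x₀),…,Y_k(x₀)` are linearly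
independent, then near `x₀` there are smooth `B : U → SO(m)` and `η : U → (0,∞)` with
`Y_i(B) = -B·C_i` and `Y_i(η) = -τ_i·η`, i.e. `T = (id_U, B, η)` turns all the `V_i` into
strong infinitesimal stochastic transformations. -/
theorem weak_to_strong_transformations
    {n m k : ℕ}
    (M : Set (Fin n → ℝ)) (hMopen : IsOpen M)
    (Y : Fin k → (Fin n → ℝ) → Fin n → ℝ)
    (C : Fin k → (Fin n → ℝ) → Fin m → Fin m → ℝ)
    (τ : Fin k → (Fin n → ℝ) → ℝ)
    (hYsmooth : ∀ i, ContDiffOn ℝ (⊤ : ℕ∞) (Y i) M)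
    (hCsmooth : ∀ i, ContDiffOn ℝ (⊤ : ℕ∞) (C i) M)
    (hτsmooth : ∀ i, ContDiffOn ℝ (⊤ : ℕ∞) (τ i) M)
    (hCso : ∀ i, ∀ x ∈ M, ∀ a b, C i x a b = - C i x b a)
    -- `K = span{V_1,…,V_k}` is a Lie algebra under the bracket of
    -- infinitesimal stochastic transformations
    (c : Fin k → Fin k → Fin k → ℝ)
    (hbrY : ∀ i j, ∀ x ∈ M, vfBracket (Y i) (Y j) x = ∑ l, c i j l • Y l x)
    (hbrC : ∀ i j, ∀ x ∈ M, ∀ a b,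
      vfApp (Y i) (fun y => C j y a b) x - vfApp (Y j) (fun y => C i y a b) x
        - (∑ e, (C i x a e * C j x e b - C j x a e * C i x e b))
      = ∑ l, c i j l * C l x a b)
    (hbrτ : ∀ i j, ∀ x ∈ M,
      vfApp (Y i) (τ j) x - vfApp (Y j) (τ i) x = ∑ l, c i j l * τ l x)
    (x₀ : Fin n → ℝ) (hx₀ : x₀ ∈ M)
    (hindep : LinearIndependent ℝ (fun i => Y i x₀)) :
    ∃ U : Set (Fin n → ℝ), IsOpen U ∧ x₀ ∈ U ∧ U ⊆ M ∧
    ∃ (B : (Fin n → ℝ) → Fin m → Fin m → ℝ) (η : (Fin n → ℝ) → ℝ),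
      ContDiffOn ℝ (⊤ : ℕ∞) B U ∧ ContDiffOn ℝ (⊤ : ℕ∞) η U ∧
      -- `B` takes values in `SO(m)`
      (∀ x ∈ U, ∀ a b, ∑ e, B x a e * B x b e = if a = b then (1:ℝ) else 0) ∧
      (∀ x ∈ U, Matrix.det (Matrix.of (B x)) = 1) ∧
      -- `η` takes values in `(0,∞)`
      (∀ x ∈ U, 0 < η x) ∧
      -- the equations `Y_i(B) = -B·C_i` and `Y_i(η) = -τ_i·η`
      (∀ i, ∀ x ∈ U, ∀ a b,
        vfApp (Y i) (fun y => B y a b) x = - ∑ e, B x a e * C i x e b) ∧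
      (∀ i, ∀ x ∈ U, vfApp (Y i) η x = - τ i x * η x) := by
  have hYd : ∀ i, ∀ x ∈ M, DifferentiableAt ℝ (Y i) x := fun i x hx =>
    ((hYsmooth i).contDiffAt (hMopen.mem_nhds hx)).differentiableAt (by simp)
  have hY' : ∀ i j, ∀ x ∈ M,
      fderiv ℝ (Y j) x (Y i x) - fderiv ℝ (Y i) x (Y j x) = ∑ l, c i j l • Y l x :=
    fun i j x hx => by
      rw [← vfBracket_eq_fderiv_sub (hYd i x hx) (hYd j x hx)]
      exact hbrY i j x hx
  open scoped Matrix Matrix.Norms.Operator in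
  have hBex : ∃ (U : Set (Fin n → ℝ)) (B : (Fin n → ℝ) → Fin m → Fin m → ℝ), IsOpen U ∧ x₀ ∈ U ∧
      U ⊆ M ∧ ContDiffOn ℝ ∞ B U ∧
      (∀ x ∈ U, ∀ a b, ∑ e, B x a e * B x b e = if a = b then (1:ℝ) else 0) ∧
      (∀ x ∈ U, Matrix.det (Matrix.of (B x)) = 1) ∧
      ∀ i, ∀ x ∈ U, ∀ a b,
        vfApp (Y i) (fun y => B y a b) x = - ∑ e, B x a e * C i x e b := by
    let L : (Fin m → Fin m → ℝ) →L[ℝ] Matrix (Fin m) (Fin m) ℝ :=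
      LinearMap.toContinuousLinearMap (Matrix.ofLinearEquiv ℝ).toLinearMap
    let C' : Fin k → (Fin n → ℝ) → Matrix (Fin m) (Fin m) ℝ := fun i x => L (C i x)
    have hC' : ∀ i, ContDiffOn ℝ ∞ (C' i) M := fun i => L.contDiff.comp_contDiffOn (hCsmooth i)
    have hCd : ∀ i, ∀ x ∈ M, DifferentiableAt ℝ (C' i) x := fun i x hx =>
      ((hC' i).contDiffAt (hMopen.mem_nhds hx)).differentiableAt (by simp)
    obtain ⟨U, B, hU, hxU, hUM, hB, horth, hdet, hBC⟩ :=
      exists_specialOrthogonal_flat_section (C := C') (c := c) hMopen hYsmooth hC'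
        (fun i x hx => Matrix.ext fun a b => hCso i x hx b a) hY'
        (fun i j x hx => Matrix.ext fun a b => by
          have h := hbrC i j x hx a b
          rw [vfApp_eq_fderiv, vfApp_eq_fderiv, Finset.sum_sub_distrib] at h
          simp only [Matrix.sub_apply, Matrix.sum_apply, Matrix.smul_apply, Matrix.mul_apply,
            ← fderiv_matrix_apply (hCd _ x hx)]
          exact h)
        hx₀ hindep
    refine ⟨U, fun x a b => B x a b, hU, hxU, hUM, ?_, fun x hx a b => ?_, hdet,
      fun i x hx a b => ?_⟩
    · exact contDiffOn_pi.2 fun a => contDiffOn_pi.2 fun b =>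
        (LinearMap.toContinuousLinearMap (Matrix.entryLinearMap ℝ ℝ a b)).contDiff.comp_contDiffOn
          hB
    · have h := congrFun (congrFun (horth x hx) a) b
      rwa [Matrix.mul_apply, Matrix.one_apply] at h
    · have hBd : DifferentiableAt ℝ B x :=
        (hB.contDiffAt (hU.mem_nhds hx)).differentiableAt (by simp)
      rw [vfApp_eq_fderiv, fderiv_matrix_apply hBd, hBC i x hx, Matrix.neg_apply, Matrix.mul_apply]
      rfl
  obtain ⟨U₁, B, hU₁, hxU₁, hU₁M, hB, horth, hdet, hBC⟩ := hBex
  obtain ⟨U₂, η, hU₂, hxU₂, -, hη, hη1, hητ, -⟩ :=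
    exists_flat_section_of_contDiffOn (c := c) hMopen hYsmooth hτsmooth hY'
      (fun i j x hx => by
        rw [← vfApp_eq_fderiv, ← vfApp_eq_fderiv, mul_comm (τ i x), sub_self, sub_zero]
        exact hbrτ i j x hx) hx₀ hindep
  refine ⟨U₁ ∩ (U₂ ∩ η ⁻¹' Set.Ioi 0),
    hU₁.inter (hη.continuousOn.isOpen_inter_preimage hU₂ isOpen_Ioi),
    ⟨hxU₁, hxU₂, by simp [hη1]⟩, Set.inter_subset_left.trans hU₁M, B, η,
    hB.mono Set.inter_subset_left, hη.mono fun x hx => hx.2.1, fun x hx => horth x hx.1,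
    fun x hx => hdet x hx.1, fun x hx => hx.2.2, fun i x hx => hBC i x hx.1, fun i x hx => ?_⟩
  rw [vfApp_eq_fderiv, hητ i x hx.2.1, mul_comm, neg_mul]
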